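/- Let Ω ⊆ ℝⁿ be open and let p : ℝⁿ × ℝⁿ → ℝ be bounded (|p| ≤ ‖p‖_∞) and log-Hölder continuous on Ω × Ω, i.e. there is a constant c > 0 such that |p(x₁,y₁) − p(x₂,y₂)| ≤ c / (−log √(|x₁−x₂|² + |y₁−y₂|²)) for all (x₁,y₁), (x₂,y₂) ∈ Ω × Ω with √(|x₁−x₂|² + |y₁−y₂|²) ≤ 1/2. Then p satisfies (P1) in Ω: there exists L > 0 (one may take L = max{e^{2c}, 8^{2‖p‖_∞}}) such that R^{p₋(B×B) − p₊(B×B)} ≤ L for every open ball B = B_R(x₀) whose closure is contained in Ω. -/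

import Mathlib

open MeasureTheory Metric Set Filter
open scoped ENNReal Topology
noncomputable section

/-- `ℝⁿ` with the Euclidean norm and Lebesgue measure. -/
abbrev Rn (n : ℕ) := EuclideanSpace ℝ (Fin n)

/-- `p₊(E × F) = sup_{x ∈ E, y ∈ F} p(x,y)`. -/
def pSup {n : ℕ} (p : Rn n → Rn n → ℝ) (E F : Set (Rn n)) : ℝ :=
  sSup (Set.image2 p E F)

/-- `p₋(E × F) = inf_{x ∈ E, y ∈ F} p(x,y)`. -/
def pInf {n : ℕ} (p : Rn n → Rn n → ℝ) (E F : Set (Rn n)) : ℝ :=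
  sInf (Set.image2 p E F)

/-- Standing assumptions on the variable exponent: continuity, symmetry and
`1 < inf p ≤ sup p < ∞`. -/
def ExponentOK {n : ℕ} (p : Rn n → Rn n → ℝ) : Prop :=
  Continuous (fun z : Rn n × Rn n => p z.1 z.2) ∧ (∀ x y, p x y = p y x) ∧
    ∃ pm pM : ℝ, 1 < pm ∧ ∀ x y, pm ≤ p x y ∧ p x y ≤ pM

/-- Membership in the fractional Sobolev space `W^{s,p(·,·)}(ℝⁿ)`. -/
def MemW {n : ℕ} (s : ℝ) (p : Rn n → Rn n → ℝ) (u : Rn n → ℝ) : Prop :=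
  Measurable u ∧
    (∫⁻ x, ENNReal.ofReal (|u x| ^ p x x)) < ⊤ ∧
    (∫⁻ x, ∫⁻ y, ENNReal.ofReal (|u x - u y| ^ p x y / ‖x - y‖ ^ ((n : ℝ) + s * p x y))) < ⊤

/-- Weak subsolution of `(-Δ)^s_{p(·,·)} u = 0` in `Ω`. -/
def IsWeakSubsol {n : ℕ} (s : ℝ) (p : Rn n → Rn n → ℝ) (Ω : Set (Rn n)) (u : Rn n → ℝ) : Prop :=
  ∀ φ : Rn n → ℝ, MemW s p φ → (∀ x, 0 ≤ φ x) → (∀ᵐ x, x ∉ Ω → φ x = 0) →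
    (∫ x, ∫ y, |u x - u y| ^ (p x y - 2) * (u x - u y) * (φ x - φ y)
      / ‖x - y‖ ^ ((n : ℝ) + s * p x y)) ≤ 0

/-- Weak supersolution of `(-Δ)^s_{p(·,·)} u = 0` in `Ω`. -/
def IsWeakSupersol {n : ℕ} (s : ℝ) (p : Rn n → Rn n → ℝ) (Ω : Set (Rn n)) (u : Rn n → ℝ) : Prop :=
  ∀ φ : Rn n → ℝ, MemW s p φ → (∀ x, 0 ≤ φ x) → (∀ᵐ x, x ∉ Ω → φ x = 0) →
    0 ≤ (∫ x, ∫ y, |u x - u y| ^ (p x y - 2) * (u x - u y) * (φ x - φ y)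
      / ‖x - y‖ ^ ((n : ℝ) + s * p x y))

/-- Weak solution of `(-Δ)^s_{p(·,·)} u = 0` in `Ω`. -/
def IsWeakSol {n : ℕ} (s : ℝ) (p : Rn n → Rn n → ℝ) (Ω : Set (Rn n)) (u : Rn n → ℝ) : Prop :=
  IsWeakSubsol s p Ω u ∧ IsWeakSupersol s p Ω u

/-- Condition (P1) in `Ω` with constant `L`. -/
def CondP1 {n : ℕ} (p : Rn n → Rn n → ℝ) (Ω : Set (Rn n)) (L : ℝ) : Prop :=
  ∀ (x₀ : Rn n) (R : ℝ), 0 < R → closedBall x₀ R ⊆ Ω →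
    R ^ (pInf p (ball x₀ R) (ball x₀ R) - pSup p (ball x₀ R) (ball x₀ R)) ≤ L

/-- Condition (P2) in `Ω`. -/
def CondP2 {n : ℕ} (p : Rn n → Rn n → ℝ) (Ω : Set (Rn n)) : Prop :=
  ∀ (x₀ : Rn n) (R : ℝ), 0 < R → closedBall x₀ R ⊆ Ω →
    pSup p (ball x₀ R) ((ball x₀ R)ᶜ) ≤ pSup p (ball x₀ R) (ball x₀ R) ∧
    pInf p (ball x₀ R) ((ball x₀ R)ᶜ) ≤ pInf p (ball x₀ R) (ball x₀ R)

lemma pSup_sub_pInf_le {n : ℕ} {p : Rn n → Rn n → ℝ} {E F : Set (Rn n)} {K : ℝ}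
    (hE : E.Nonempty) (hF : F.Nonempty)
    (hK : ∀ x₁ ∈ E, ∀ y₁ ∈ F, ∀ x₂ ∈ E, ∀ y₂ ∈ F, |p x₁ y₁ - p x₂ y₂| ≤ K) :
    pSup p E F - pInf p E F ≤ K := by
  have hne : (Set.image2 p E F).Nonempty := hE.image2 hF
  suffices pSup p E F ≤ K + pInf p E F by linarith
  refine csSup_le hne ?_
  rintro _ ⟨x₁, hx₁, y₁, hy₁, rfl⟩
  suffices p x₁ y₁ - K ≤ pInf p E F by linarith
  refine le_csInf hne ?_
  rintro _ ⟨x₂, hx₂, y₂, hy₂, rfl⟩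
  linarith [le_of_abs_le (hK x₁ hx₁ y₁ hy₁ x₂ hx₂ y₂ hy₂)]

lemma pInf_le_pSup {n : ℕ} {p : Rn n → Rn n → ℝ} {E F : Set (Rn n)} {M : ℝ}
    (hE : E.Nonempty) (hF : F.Nonempty) (hM : ∀ x y, |p x y| ≤ M) :
    pInf p E F ≤ pSup p E F := by
  refine csInf_le_csSup (hE.image2 hF) ?_ ?_
  · exact ⟨-M, by rintro _ ⟨x, -, y, -, rfl⟩; exact neg_le_of_abs_le (hM x y)⟩
  · exact ⟨M, by rintro _ ⟨x, -, y, -, rfl⟩; exact le_of_abs_le (hM x y)⟩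

lemma rpow_neg_le_rpow_of_inv_le {a R d D : ℝ} (ha : 1 ≤ a) (hR : a⁻¹ ≤ R) (hd : 0 ≤ d)
    (hdD : d ≤ D) : R ^ (-d) ≤ a ^ D := by
  have ha₀ : 0 < a := by linarith
  calc R ^ (-d) ≤ a⁻¹ ^ (-d) :=
        Real.rpow_le_rpow_of_nonpos (inv_pos.2 ha₀) hR (by linarith)
    _ = a ^ d := by rw [Real.inv_rpow ha₀.le, Real.rpow_neg ha₀.le, inv_inv]
    _ ≤ a ^ D := Real.rpow_le_rpow_of_exponent_le ha hdD

lemma div_neg_log_sqrt_le {c R s : ℝ} (hc : 0 ≤ c) (hR₀ : 0 < R) (hR₁ : R < 1) (hs₀ : 0 ≤ s)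
    (hs : s ≤ R) : c / (-Real.log (Real.sqrt s)) ≤ 2 * c / (-Real.log R) := by
  have hlogR : Real.log R < 0 := Real.log_neg hR₀ hR₁
  rcases hs₀.eq_or_lt with rfl | hs_pos
  · simpa using div_nonneg (by linarith : (0 : ℝ) ≤ 2 * c) (by linarith : 0 ≤ -Real.log R)
  · have hlog : Real.log s ≤ Real.log R := Real.log_le_log hs_pos hs
    rw [Real.log_sqrt hs₀, div_le_div_iff₀ (by linarith) (by linarith)]
    nlinarith

/-- log-Hölder continuity of a bounded exponent implies condition (P1). -/
theorem statement11 {n : ℕ} (hn : 1 ≤ n) (Ω : Set (Rn n)) (hΩ : IsOpen Ω)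
    (p : Rn n → Rn n → ℝ) (M : ℝ) (hM : ∀ x y, |p x y| ≤ M)
    (c : ℝ) (hc : 0 < c)
    (hlog : ∀ x₁ y₁ x₂ y₂ : Rn n, x₁ ∈ Ω → y₁ ∈ Ω → x₂ ∈ Ω → y₂ ∈ Ω →
      Real.sqrt (‖x₁ - x₂‖ ^ 2 + ‖y₁ - y₂‖ ^ 2) ≤ 1 / 2 →
      |p x₁ y₁ - p x₂ y₂| ≤ c / (-Real.log (Real.sqrt (‖x₁ - x₂‖ ^ 2 + ‖y₁ - y₂‖ ^ 2)))) :
    ∃ L > 0, CondP1 p Ω L := by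
  refine ⟨max (Real.exp (2 * c)) (8 ^ (2 * M)), lt_max_of_lt_left (Real.exp_pos _), ?_⟩
  intro x₀ R hR hsub
  have hne : (ball x₀ R).Nonempty := ⟨x₀, mem_ball_self hR⟩
  rw [← neg_sub]
  rcases le_or_gt (8 : ℝ)⁻¹ R with hR8 | hR8
  · refine le_max_of_le_right (rpow_neg_le_rpow_of_inv_le (by norm_num) hR8
      (sub_nonneg.2 (pInf_le_pSup hne hne hM)) (pSup_sub_pInf_le hne hne ?_))
    intro x₁ _ y₁ _ x₂ _ y₂ _
    linarith [abs_sub (p x₁ y₁) (p x₂ y₂), hM x₁ y₁, hM x₂ y₂]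
  · refine le_max_of_le_left ?_
    have hR1 : R < 1 := hR8.trans (by norm_num)
    have hlogR : Real.log R < 0 := Real.log_neg hR hR1
    have hΩ' : ∀ x ∈ ball x₀ R, x ∈ Ω := fun x hx => hsub (ball_subset_closedBall hx)
    have hdist : ∀ x ∈ ball x₀ R, ∀ y ∈ ball x₀ R, ‖x - y‖ ^ 2 ≤ (2 * R) ^ 2 := by
      intro x hx y hy
      rw [← dist_eq_norm]
      gcongr
      linarith [dist_triangle_right x y x₀, mem_ball.1 hx, mem_ball.1 hy]
    have hosc : pSup p (ball x₀ R) (ball x₀ R) - pInf p (ball x₀ R) (ball x₀ R) ≤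
        2 * c / (-Real.log R) := by
      refine pSup_sub_pInf_le hne hne ?_
      intro x₁ hx₁ y₁ hy₁ x₂ hx₂ y₂ hy₂
      have hx := hdist x₁ hx₁ x₂ hx₂
      have hy := hdist y₁ hy₁ y₂ hy₂
      refine (hlog x₁ y₁ x₂ y₂ (hΩ' _ hx₁) (hΩ' _ hy₁) (hΩ' _ hx₂) (hΩ' _ hy₂) ?_).trans
        (div_neg_log_sqrt_le hc.le hR hR1 (by positivity) (by nlinarith))
      exact Real.sqrt_le_iff.2 ⟨by norm_num, by nlinarith⟩
    rw [Real.rpow_def_of_pos hR, Real.exp_le_exp]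
    rw [le_div_iff₀ (by linarith)] at hosc
    linarith
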